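/- Let D = diag(λ₁,…,λₙ) be a diagonal n×n complex matrix with λ_k > 0 for all k and Σ_{k=1}^n λ_k = 1, let f ∈ F_op, and let A⁽¹⁾,…,A⁽ᴺ⁾ be Hermitian n×n complex matrices. Then det(Cov_D) ≥ det(qCov^{s}_{D,f}), where Cov_D = Cov_{D,g_cl} and qCov^{s}_{D,f} = Cov_{D,g_f^{s}}. -/

import Mathlib

open ComplexOrder Matrix

/-- The diagonal density matrix `D = diag(λ₁,…,λₙ)`. -/
noncomputable def Dmat {n : ℕ} (lam : Fin n → ℝ) : Matrix (Fin n) (Fin n) ℂ :=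
  Matrix.diagonal fun k => (lam k : ℂ)

/-- `A₀ = A - Tr(D A)·I`. -/
noncomputable def cent {n : ℕ} (lam : Fin n → ℝ) (A : Matrix (Fin n) (Fin n) ℂ) :
    Matrix (Fin n) (Fin n) ℂ :=
  A - (Dmat lam * A).trace • (1 : Matrix (Fin n) (Fin n) ℂ)

/-- The `N×N` covariance matrix `[Cov_{D,g}]_{ij} = (A⁽ⁱ⁾₀, A⁽ʲ⁾₀)_{D,g}` where
`(A,B)_{D,g} = Σ_{k,l} A_{lk}·B_{kl}·g(λ_k,λ_l)`. -/
noncomputable def covM {n N : ℕ} (lam : Fin n → ℝ) (g : ℝ → ℝ → ℝ)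
    (A : Fin N → Matrix (Fin n) (Fin n) ℂ) : Matrix (Fin N) (Fin N) ℂ :=
  Matrix.of fun i j =>
    ∑ k, ∑ l, (g (lam k) (lam l) : ℂ) * cent lam (A i) l k * cent lam (A j) k l
/-- `f ∈ F_op`: `f : (0,∞) → (0,∞)` is operator monotone (via the continuous functional
calculus on Hermitian matrices, with the Loewner order expressed through `PosSemidef`),
satisfies `f(x) = x·f(1/x)` for `x > 0`, and `f(1) = 1`. -/
structure IsFop (f : ℝ → ℝ) : Prop where
  pos : ∀ x : ℝ, 0 < x → 0 < f x
  opMono : ∀ (m : ℕ) (X Y : Matrix (Fin m) (Fin m) ℂ), X.PosSemidef → Y.PosSemidef →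
    (Y - X).PosSemidef → (cfc f Y - cfc f X).PosSemidef
  funcEq : ∀ x : ℝ, 0 < x → f x = x * f x⁻¹
  normalized : f 1 = 1

/-- `f(0) = lim_{t→0⁺} f(t)`. -/
def IsFzero (f : ℝ → ℝ) (f0 : ℝ) : Prop :=
  Filter.Tendsto f (nhdsWithin 0 (Set.Ioi 0)) (nhds f0)

/-- `m_f(x,y) = y·f(x/y)`. -/
noncomputable def mfun (f : ℝ → ℝ) (x y : ℝ) : ℝ := y * f (x / y)

/-- `g_cl(x,y) = (x+y)/2`. -/
noncomputable def gcl (x y : ℝ) : ℝ := (x + y) / 2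

/-- `g_f^{as}(x,y) = f(0)·(x−y)²/(2·m_f(x,y))`. -/
noncomputable def gas (f : ℝ → ℝ) (f0 : ℝ) (x y : ℝ) : ℝ :=
  f0 * (x - y) ^ 2 / (2 * mfun f x y)

/-- `g_f^{s}(x,y) = f(0)·(x+y)²/(2·m_f(x,y))`. -/
noncomputable def gs (f : ℝ → ℝ) (f0 : ℝ) (x y : ℝ) : ℝ :=
  f0 * (x + y) ^ 2 / (2 * mfun f x y)

/-- A real 2×2 symmetric matrix with nonnegative leading minors is PSD. -/
lemma psd_two (a b c : ℝ) (ha : 0 < a) (h : b ^ 2 ≤ a * c) :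
    (!![(a : ℂ), (b : ℂ); (b : ℂ), (c : ℂ)]).PosSemidef := by
  have h1 : (!![(a : ℂ), (b : ℂ); (b : ℂ), (c : ℂ)]) =
      (!![(a : ℂ), (b : ℂ); 0, 0])ᴴ * Matrix.diagonal (fun _ => ((a⁻¹ : ℝ) : ℂ))
        * (!![(a : ℂ), (b : ℂ); 0, 0])
      + Matrix.diagonal ![0, ((c - b ^ 2 / a : ℝ) : ℂ)] := by
    have ha' : (a : ℂ) ≠ 0 := by exact_mod_cast ha.ne'
    ext i j
    fin_cases i <;> fin_cases j <;>
      simp [Matrix.mul_apply, Fin.sum_univ_two, Matrix.diagonal] <;> field_simp <;> ring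
  rw [h1]
  refine Matrix.PosSemidef.add (Matrix.PosSemidef.conjTranspose_mul_mul_same ?_ _) ?_
  · apply Matrix.PosSemidef.diagonal
    intro i
    have : (0 : ℝ) ≤ a⁻¹ := by positivity
    exact Complex.zero_le_real.mpr this
  · apply Matrix.PosSemidef.diagonal
    intro i
    have : (0 : ℝ) ≤ c - b ^ 2 / a := by
      rw [sub_nonneg, div_le_iff₀ ha]; linarith
    fin_cases i
    · simp
    · simpa using (by exact_mod_cast this : (0 : ℂ) ≤ ((c - b ^ 2 / a : ℝ) : ℂ))

/-- On a symmetric 2×2 matrix with distinct eigenvalues `p, q`, the functional calculus is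
affine interpolation; we record the upper-left entry. -/
lemma cfc_two (f : ℝ → ℝ) (t b s p q : ℝ) (hpq : p ≠ q) (htr : t + s = p + q)
    (hdet : t * s - b ^ 2 = p * q) :
    (cfc f (!![(t : ℂ), (b : ℂ); (b : ℂ), (s : ℂ)])) 0 0 =
      ((f p + (f q - f p) / (q - p) * (t - p) : ℝ) : ℂ) := by
  set Y : Matrix (Fin 2) (Fin 2) ℂ := !![(t : ℂ), (b : ℂ); (b : ℂ), (s : ℂ)] with hY
  have hsa : IsSelfAdjoint Y := by
    change star Y = Y
    ext i j
    fin_cases i <;> fin_cases j <;> simp [hY, Matrix.star_apply]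
  have hqp : q - p ≠ 0 := sub_ne_zero.mpr hpq.symm
  set β := (f q - f p) / (q - p) with hβ
  have hc : cfc f Y = cfc (fun x => (f p - β * p) + β * x) Y := by
    apply cfc_congr
    intro μ hμ
    have h0 : (algebraMap ℝ (Matrix (Fin 2) (Fin 2) ℂ) μ - Y).det = 0 := by
      by_contra hne
      exact hμ ((Matrix.isUnit_iff_isUnit_det _).mpr (isUnit_iff_ne_zero.mpr hne))
    rw [Matrix.det_fin_two] at h0
    simp [hY, Matrix.algebraMap_matrix_apply] at h0
    have h1 : (μ - t) * (μ - s) - b * b = 0 := by exact_mod_cast h0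
    have h2 : (μ - p) * (μ - q) = 0 := by
      linear_combination h1 - hdet + μ * htr
    rcases mul_eq_zero.mp h2 with h | h
    · have : μ = p := by linarith
      subst this; simp
    · have : μ = q := by linarith
      subst this
      simp only [hβ]; field_simp; ring
  rw [hc, cfc_const_add (f p - β * p) (fun x => β * x) Y (by fun_prop) hsa,
    cfc_const_mul_id β Y hsa]
  rw [Matrix.add_apply, Matrix.algebraMap_matrix_apply]
  simp [hY]
  ring

lemma key_ineq {f : ℝ → ℝ} (hf : IsFop f) (p q t d : ℝ) (hp : 0 < p) (hpt : p ≤ t) (htq : t ≤ q)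
    (hpq : p < q) (hd : 0 < d) :
    f p + (f q - f p) / (q - p) * (t - p) ≤ f (t + d) := by
  set s := p + q - t with hs
  have hspos : 0 < s := by linarith
  have hb0 : 0 ≤ (t - p) * (q - t) := mul_nonneg (by linarith) (by linarith)
  set b := Real.sqrt ((t - p) * (q - t)) with hb
  have hb2 : b ^ 2 = (t - p) * (q - t) := Real.sq_sqrt hb0
  have hdb : 0 ≤ b ^ 2 / d := by positivity
  set M := s + b ^ 2 / d + (t + d) with hM
  have hY := psd_two t b s (by linarith) (by rw [hb2, hs]; nlinarith)
  have hZ := psd_two (t + d) 0 M (by linarith) (by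
    have : 0 ≤ (t + d) * M := mul_nonneg (by linarith) (by linarith)
    simpa using this)
  have hd2 : d * (b ^ 2 / d) = b ^ 2 := by field_simp
  have hZY := psd_two d (-b) (M - s) hd (by rw [hM]; nlinarith)
  have h := hf.opMono 2 _ _ hY hZ (by
    convert hZY using 1
    ext i j
    fin_cases i <;> fin_cases j <;> simp)
  have h00 := h.diag_nonneg (i := 0)
  rw [Matrix.sub_apply, cfc_two f t b s p q hpq.ne (by rw [hs]; ring) (by rw [hb2, hs]; ring),
    cfc_two f (t + d) 0 M (t + d) M (by linarith) rfl (by ring), ← Complex.ofReal_sub,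
    Complex.zero_le_real] at h00
  simp at h00
  linarith

lemma fop_lower {f : ℝ → ℝ} (hf : IsFop f) {f0 : ℝ} (hf0 : IsFzero f f0) (x : ℝ) (hx : 0 < x) :
    f0 * (1 + x) ≤ f x := by
  have hid : Filter.Tendsto (fun d : ℝ => d) (nhdsWithin 0 (Set.Ioi 0)) (nhds 0) :=
    Filter.tendsto_id.mono_left nhdsWithin_le_nhds
  have hc : Filter.Tendsto
      (fun d : ℝ => (1 - d * (x - 2 * d) / (1 - d ^ 2)) + (x - 2 * d) / (1 - d ^ 2))
      (nhdsWithin 0 (Set.Ioi 0)) (nhds (1 + x)) := by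
    have : ContinuousAt
      (fun d : ℝ => (1 - d * (x - 2 * d) / (1 - d ^ 2)) + (x - 2 * d) / (1 - d ^ 2)) 0 := by
      have h1 : (1 : ℝ) - 0 ^ 2 ≠ 0 := by norm_num
      fun_prop (disch := exact h1)
    have h2 := this.tendsto
    simp at h2
    exact h2.mono_left nhdsWithin_le_nhds
  refine le_of_tendsto (Filter.Tendsto.mul hf0 hc) ?_
  have e1 : ∀ᶠ d : ℝ in nhdsWithin 0 (Set.Ioi 0), d < 1 / 2 := hid.eventually_lt_const (by norm_num)
  have e2 : ∀ᶠ d : ℝ in nhdsWithin 0 (Set.Ioi 0), d < x / 2 := hid.eventually_lt_const (by linarith)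
  have e3 : ∀ᶠ d : ℝ in nhdsWithin 0 (Set.Ioi 0), d < 1 / x := hid.eventually_lt_const (by positivity)
  filter_upwards [e1, e2, e3, self_mem_nhdsWithin] with d h1 h2 h3 hd
  have hd : 0 < d := hd
  have hdx : x ≤ d⁻¹ := by
    rw [lt_div_iff₀ hx] at h3
    rw [← one_div, le_div_iff₀ hd]; linarith
  have hdd : d < d⁻¹ := by
    rw [← one_div, lt_div_iff₀ hd]; nlinarith
  have hk := key_ineq hf d d⁻¹ (x - d) d hd (by linarith) (by linarith) hdd hd
  have hfe : f d⁻¹ = d⁻¹ * f d := by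
    have := hf.funcEq d⁻¹ (by positivity)
    rwa [inv_inv] at this
  have hn : 1 - d ^ 2 ≠ 0 := by nlinarith
  rw [hfe, sub_add_cancel] at hk
  refine le_trans (le_of_eq ?_) hk
  have hdn := hd.ne'
  have : d⁻¹ - d = (1 - d ^ 2) / d := by field_simp
  rw [this]
  field_simp
  ring

lemma det_one_add {N : ℕ} (P : Matrix (Fin N) (Fin N) ℂ) (hP : P.PosSemidef) :
    ∃ r : ℝ, 1 ≤ r ∧ (1 + P).det = r := by
  have hQ : (1 + P).IsHermitian := Matrix.isHermitian_one.add hP.1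
  refine ⟨∏ i, hQ.eigenvalues i, ?_, ?_⟩
  · have h : ∀ i, 1 ≤ hQ.eigenvalues i := by
      intro i
      by_contra hlt
      push Not at hlt
      have hmem : hQ.eigenvalues i ∈ spectrum ℝ (1 + P) := by
        rw [hQ.spectrum_real_eq_range_eigenvalues]; exact ⟨i, rfl⟩
      set μ := hQ.eigenvalues i
      refine hmem (?_ : IsUnit (algebraMap ℝ (Matrix (Fin N) (Fin N) ℂ) μ - (1 + P)))
      have hpd : (((1 - μ : ℝ) : ℂ) • (1 : Matrix (Fin N) (Fin N) ℂ) + P).PosDef := by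
        refine Matrix.PosDef.add_posSemidef (Matrix.PosDef.one.smul ?_) hP
        have : (0 : ℝ) < 1 - μ := by linarith
        exact_mod_cast this
      have := hpd.isUnit.neg
      convert this using 1
      ext i j
      by_cases hij : i = j <;> simp [Matrix.algebraMap_matrix_apply, hij, Matrix.one_apply] <;> ring
    calc (1 : ℝ) = ∏ _i : Fin N, (1 : ℝ) := by simp
      _ ≤ _ := Finset.prod_le_prod (fun _ _ => zero_le_one) fun i _ => h i
  · rw [hQ.det_eq_prod_eigenvalues]; push_cast; rfl

open scoped MatrixOrder Matrix.Norms.L2Operator in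
lemma exists_factor {N : ℕ} (A : Matrix (Fin N) (Fin N) ℂ) (hA : A.PosSemidef) :
    ∃ B : Matrix (Fin N) (Fin N) ℂ, A = Bᴴ * B :=
  CStarAlgebra.nonneg_iff_eq_star_mul_self.mp hA.nonneg

lemma det_mono {N : ℕ} (A C : Matrix (Fin N) (Fin N) ℂ) (hA : A.PosSemidef) (hC : C.PosSemidef) :
    A.det.re ≤ (A + C).det.re := by
  by_cases h0 : A.det = 0
  · rw [h0]
    exact (Complex.le_def.mp (hA.add hC).det_nonneg).1
  · obtain ⟨B, hB⟩ := exists_factor A hA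
    have hBd : IsUnit B.det := by
      rw [isUnit_iff_ne_zero]
      intro h; apply h0; rw [hB, Matrix.det_mul, h, mul_zero]
    have hP := hC.conjTranspose_mul_mul_same B⁻¹
    obtain ⟨r, hr, hdet⟩ := det_one_add _ hP
    have hfac : A + C = Bᴴ * (1 + (B⁻¹)ᴴ * C * B⁻¹) * B := by
      have e1 : Bᴴ * (B⁻¹)ᴴ = 1 := by
        rw [← Matrix.conjTranspose_mul, Matrix.nonsing_inv_mul _ hBd, Matrix.conjTranspose_one]
      have e2 : B⁻¹ * B = 1 := Matrix.nonsing_inv_mul _ hBd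
      calc A + C = Bᴴ * B + (Bᴴ * (B⁻¹)ᴴ) * C * (B⁻¹ * B) := by rw [e1, e2, hB]; simp
        _ = _ := by noncomm_ring
    have hd : (A + C).det = A.det * r := by
      rw [hfac, Matrix.det_mul, Matrix.det_mul, hdet, hB, Matrix.det_mul]; ring
    rw [hd, Complex.re_mul_ofReal]
    have := (Complex.le_def.mp hA.det_nonneg).1
    simp at this
    nlinarith

lemma cent_herm {n : ℕ} (lam : Fin n → ℝ) (A : Matrix (Fin n) (Fin n) ℂ) (hA : A.IsHermitian) :
    (cent lam A).IsHermitian := by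
  unfold cent
  refine hA.sub ?_
  have : star (Dmat lam * A).trace = (Dmat lam * A).trace := by
    simp only [Dmat, Matrix.trace, Matrix.diag, Matrix.diagonal_mul, star_sum, star_mul']
    refine Finset.sum_congr rfl fun k _ => ?_
    rw [hA.apply]
    simp
  change _ᴴ = _
  rw [Matrix.conjTranspose_smul, this, Matrix.conjTranspose_one]

lemma covM_psd {n N : ℕ} (lam : Fin n → ℝ) (g : ℝ → ℝ → ℝ) (hg : ∀ k l, 0 ≤ g (lam k) (lam l))
    (A : Fin N → Matrix (Fin n) (Fin n) ℂ) (hA : ∀ a, (A a).IsHermitian) :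
    (covM lam g A).PosSemidef := by
  let V : Matrix (Fin n × Fin n) (Fin N) ℂ := Matrix.of fun p j => cent lam (A j) p.1 p.2
  have h : covM lam g A =
      Vᴴ * Matrix.diagonal (fun p : Fin n × Fin n => (g (lam p.1) (lam p.2) : ℂ)) * V := by
    ext i j
    rw [Matrix.mul_apply, Fintype.sum_prod_type]
    simp only [Matrix.mul_diagonal, covM, Matrix.of_apply, V, Matrix.conjTranspose_apply]
    refine Finset.sum_congr rfl fun k _ => Finset.sum_congr rfl fun l _ => ?_
    rw [(cent_herm lam (A i) (hA i)).apply]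
    ring
  rw [h]
  apply Matrix.PosSemidef.conjTranspose_mul_mul_same
  apply Matrix.PosSemidef.diagonal
  intro p
  exact Complex.zero_le_real.mpr (hg p.1 p.2)

/-- `det(Cov_D) ≥ det(qCov^{s}_{D,f})`. -/
theorem det_cov_ge_det_qCov_s (n N : ℕ) (lam : Fin n → ℝ)
    (hlam : ∀ k, 0 < lam k) (hsum : ∑ k, lam k = 1)
    (f : ℝ → ℝ) (hf : IsFop f) (f0 : ℝ) (hf0 : IsFzero f f0)
    (A : Fin N → Matrix (Fin n) (Fin n) ℂ) (hA : ∀ a, (A a).IsHermitian) :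
    (covM lam (gs f f0) A).det.re ≤ (covM lam gcl A).det.re := by
  have hf0n : 0 ≤ f0 := ge_of_tendsto hf0 (by
    filter_upwards [self_mem_nhdsWithin] with x hx using (hf.pos x hx).le)
  have hm : ∀ x y : ℝ, 0 < x → 0 < y → 0 < mfun f x y := fun x y hx hy =>
    mul_pos hy (hf.pos _ (div_pos hx hy))
  have hgs : ∀ x y : ℝ, 0 < x → 0 < y → 0 ≤ gs f f0 x y := fun x y hx hy => by
    have := hm x y hx hy
    unfold gs; positivity
  have hle : ∀ x y : ℝ, 0 < x → 0 < y → gs f f0 x y ≤ gcl x y := fun x y hx hy => by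
    have h1 := hm x y hx hy
    have h2 := fop_lower hf hf0 (x / y) (div_pos hx hy)
    have h3 : f0 * (x + y) ≤ mfun f x y := by
      have := mul_le_mul_of_nonneg_left h2 hy.le
      unfold mfun
      refine le_trans (le_of_eq ?_) this
      field_simp
      ring
    unfold gs gcl
    rw [div_le_iff₀ (by positivity)]
    nlinarith [mul_le_mul_of_nonneg_left h3 (by positivity : 0 ≤ x + y)]
  have h1 := covM_psd lam (gs f f0) (fun k l => hgs _ _ (hlam k) (hlam l)) A hA
  have h2 := covM_psd lam (fun x y => gcl x y - gs f f0 x y)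
    (fun k l => sub_nonneg.mpr (hle _ _ (hlam k) (hlam l))) A hA
  have h3 : covM lam gcl A = covM lam (gs f f0) A +
      covM lam (fun x y => gcl x y - gs f f0 x y) A := by
    ext i j
    simp only [covM, Matrix.add_apply, Matrix.of_apply, ← Finset.sum_add_distrib]
    refine Finset.sum_congr rfl fun k _ => Finset.sum_congr rfl fun l _ => ?_
    push_cast
    ring
  rw [h3]
  exact det_mono _ _ h1 h2
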